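/- For every complex number d with Re(d) > 0, there holds ₃F₂(3, 1, d+1; 7/2, d; 1/2) = (5π/2)[3(1/2 − 1/d) + (2/π)(5/d − 2)]. -/

import Mathlib

open scoped Nat

/-- Pochhammer symbol `(x)_k = x (x+1) ⋯ (x+k-1)` for a complex number `x`. -/
noncomputable def poch (x : ℂ) (k : ℕ) : ℂ := (ascPochhammer ℂ k).eval x

/-- The generalized hypergeometric series
`ₚF_q(a₁,…,aₚ; b₁,…,b_q; z) = ∑ₖ ((a₁)ₖ ⋯ (aₚ)ₖ)/((b₁)ₖ ⋯ (b_q)ₖ) · zᵏ/k!`. -/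
noncomputable def hyp (a b : List ℂ) (z : ℂ) : ℂ :=
  ∑' k : ℕ, ((a.map (poch · k)).prod / (b.map (poch · k)).prod) * z ^ k / (k ! : ℂ)

/-- The integral `∫₀^π sin x / (1 + cos² x) dx`. -/
theorem integral_sin_div_one_add_cos_sq :
    ∫ x in (0 : ℝ)..Real.pi, Real.sin x / (1 + Real.cos x ^ 2) = Real.pi / 2 := by
  have hderiv : ∀ x ∈ Set.uIcc 0 Real.pi,
      HasDerivAt (fun y => -Real.arctan (Real.cos y))
        (Real.sin x / (1 + Real.cos x ^ 2)) x := by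
    intro x _
    have h := (Real.hasDerivAt_cos x).arctan.neg
    rwa [show -(1 / (1 + Real.cos x ^ 2) * -Real.sin x) = Real.sin x / (1 + Real.cos x ^ 2) by
      ring] at h
  have hcont : Continuous fun x : ℝ => Real.sin x / (1 + Real.cos x ^ 2) :=
    Real.continuous_sin.div (by fun_prop) fun x => by positivity
  rw [intervalIntegral.integral_eq_sub_of_hasDerivAt hderiv (hcont.intervalIntegrable _ _)]
  simp [Real.arctan_neg]
  ring

/-- The terms `k! / (2k+1)‼` of Euler's series for `π / 2`. -/
noncomputable def eulerTerm (k : ℕ) : ℝ := ∏ i ∈ Finset.range k, ((i : ℝ) + 1) / (2 * i + 3)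

theorem eulerTerm_succ (k : ℕ) : eulerTerm (k + 1) = eulerTerm k * ((k + 1) / (2 * k + 3)) :=
  Finset.prod_range_succ _ _

theorem eulerTerm_nonneg (k : ℕ) : 0 ≤ eulerTerm k :=
  Finset.prod_nonneg fun _ _ => by positivity

theorem eulerTerm_le (k : ℕ) : eulerTerm k ≤ (1 / 2) ^ k := by
  induction k with
  | zero => simp [eulerTerm]
  | succ k ih =>
    rw [eulerTerm_succ, pow_succ]
    refine mul_le_mul ih ?_ (by positivity) (by positivity)
    rw [div_le_div_iff₀ (by positivity) (by norm_num)]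
    linarith

theorem eulerTerm_eq_integral (k : ℕ) :
    eulerTerm k = ∫ x in (0 : ℝ)..Real.pi, Real.sin x / 2 * (Real.sin x ^ 2 / 2) ^ k := by
  have h : ∀ x : ℝ, Real.sin x / 2 * (Real.sin x ^ 2 / 2) ^ k =
      (1 / 2) ^ (k + 1) * Real.sin x ^ (2 * k + 1) := fun x => by
    rw [div_pow, ← pow_mul, div_pow, one_pow]
    ring
  simp_rw [h]
  rw [intervalIntegral.integral_const_mul, integral_sin_pow_odd]
  have hprod : ∏ i ∈ Finset.range k, (2 * (i : ℝ) + 2) / (2 * i + 3) = 2 ^ k * eulerTerm k := by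
    rw [eulerTerm, Finset.pow_eq_prod_const, ← Finset.prod_mul_distrib]
    exact Finset.prod_congr rfl fun i _ => by ring
  rw [hprod, pow_succ, one_div, inv_pow]
  field_simp

/-- Euler's series `∑ k! / (2k+1)‼ = π / 2`. -/
theorem hasSum_eulerTerm : HasSum eulerTerm (Real.pi / 2) := by
  rw [← integral_sin_div_one_add_cos_sq]
  simp_rw [funext eulerTerm_eq_integral]
  have hsq : ∀ x : ℝ, Real.sin x ^ 2 / 2 ≤ 1 / 2 := fun x => by
    linarith [Real.sin_sq_le_one x]
  refine intervalIntegral.hasSum_integral_of_dominated_convergence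
    (fun k _ => (1 / 2 : ℝ) ^ k) (fun k => ?_) (fun k => ?_) ?_ ?_ ?_
  · exact Continuous.aestronglyMeasurable (by fun_prop)
  · refine Filter.Eventually.of_forall fun x _ => ?_
    rw [norm_mul, norm_pow, Real.norm_of_nonneg (by positivity : 0 ≤ Real.sin x ^ 2 / 2),
      Real.norm_eq_abs, abs_div, abs_two]
    have h1 : |Real.sin x| / 2 ≤ 1 := by linarith [Real.abs_sin_le_one x]
    have h2 : (Real.sin x ^ 2 / 2) ^ k ≤ (1 / 2) ^ k := by gcongr ?_ ^ k; exact hsq x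
    calc _ ≤ 1 * (1 / 2 : ℝ) ^ k := by gcongr
      _ = _ := one_mul _
  · exact Filter.Eventually.of_forall fun x _ =>
      summable_geometric_of_lt_one (by norm_num) (by norm_num)
  · exact intervalIntegrable_const
  · refine Filter.Eventually.of_forall fun x _ => ?_
    have hgeom := (hasSum_geometric_of_lt_one (by positivity : 0 ≤ Real.sin x ^ 2 / 2)
      (by linarith [hsq x])).mul_left (Real.sin x / 2)
    have h1 : (1 : ℝ) + Real.cos x ^ 2 = 2 * (1 - Real.sin x ^ 2 / 2) := by
      linarith [Real.sin_sq_add_cos_sq x]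
    have h3 : Real.sin x / (1 + Real.cos x ^ 2) =
        Real.sin x / 2 * (1 - Real.sin x ^ 2 / 2)⁻¹ := by
      rw [h1, div_mul_eq_div_div, div_eq_mul_inv _ (1 - _)]
    rwa [h3]

theorem hasSum_mul_eulerTerm : HasSum (fun k : ℕ => (k : ℝ) * eulerTerm k) 1 := by
  rw [hasSum_iff_tendsto_nat_of_nonneg fun k => mul_nonneg k.cast_nonneg (eulerTerm_nonneg k)]
  have hsum : ∀ n : ℕ, ∑ k ∈ Finset.range n, (k : ℝ) * eulerTerm k =
      1 - (2 * n + 1) * eulerTerm n := by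
    intro n
    induction n with
    | zero => simp [eulerTerm]
    | succ n ih =>
      rw [Finset.sum_range_succ, ih, eulerTerm_succ]
      push_cast
      field_simp
      ring
  have hlim : Filter.Tendsto (fun n : ℕ => (2 * (n : ℝ) + 1) * (1 / 2) ^ n)
      Filter.atTop (nhds 0) := by
    have h1 := tendsto_self_mul_const_pow_of_lt_one (r := (1 / 2 : ℝ)) (by norm_num) (by norm_num)
    have h2 := tendsto_pow_atTop_nhds_zero_of_lt_one (r := (1 / 2 : ℝ)) (by norm_num) (by norm_num)
    convert (h1.const_mul 2).add h2 using 2 <;> ring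
  have hzero : Filter.Tendsto (fun n : ℕ => (2 * (n : ℝ) + 1) * eulerTerm n)
      Filter.atTop (nhds 0) :=
    squeeze_zero (fun n => mul_nonneg (by positivity) (eulerTerm_nonneg n))
      (fun n => by gcongr; exact eulerTerm_le n) hlim
  simpa [hsum] using hzero.const_sub 1

theorem poch_succ (x : ℂ) (k : ℕ) : poch x (k + 1) = poch x k * (x + k) := by
  simp [poch, ascPochhammer_succ_eval]

theorem poch_one (k : ℕ) : poch 1 k = (k ! : ℂ) := by
  simp [poch]

theorem poch_ne_zero {x : ℂ} (hx : 0 < x.re) (k : ℕ) : poch x k ≠ 0 := by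
  induction k with
  | zero => simp [poch]
  | succ k ih =>
    rw [poch_succ]
    refine mul_ne_zero ih fun h => ?_
    have := congrArg Complex.re h
    simp only [Complex.add_re, Complex.natCast_re, Complex.zero_re] at this
    linarith [k.cast_nonneg (α := ℝ)]

theorem mul_poch_add_one (x : ℂ) (k : ℕ) : x * poch (x + 1) k = poch x k * (x + k) := by
  induction k with
  | zero => simp [poch]
  | succ k ih =>
    rw [poch_succ, poch_succ, ← mul_assoc, ih]
    push_cast
    ring

theorem poch_three_div_poch (k : ℕ) :
    poch 3 k / poch (7 / 2) k * (1 / 2) ^ k = 15 / 2 * (eulerTerm (k + 2) : ℂ) := by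
  induction k with
  | zero => norm_num [poch, eulerTerm, Finset.prod_range_succ]
  | succ k ih =>
    have h : (2 * (k : ℂ) + 7) ≠ 0 := by exact_mod_cast (by positivity : 2 * k + 7 ≠ 0)
    have h' : (7 / 2 + (k : ℂ)) = (2 * k + 7) / 2 := by ring
    have h'' : (2 * ((k : ℂ) + 2) + 3) = 2 * k + 7 := by ring
    calc _ = poch 3 k / poch (7 / 2) k * (1 / 2) ^ k * ((k + 3) / (2 * k + 7)) := by
          rw [poch_succ, poch_succ, pow_succ, h', mul_div_mul_comm]
          field_simp
          ring
      _ = _ := by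
          rw [ih, show k + 1 + 2 = k + 2 + 1 from rfl, eulerTerm_succ (k + 2)]
          push_cast
          rw [h'']
          ring

theorem gauss_second_m1_n0 (d : ℂ) (hd : 0 < d.re) :
    hyp [3, 1, d + 1] [7/2, d] (1/2) =
      5 * (Real.pi : ℂ) / 2 *
        (3 * (1/2 - 1 / d) + 2 / (Real.pi : ℂ) * (5 / d - 2)) := by
  have hd0 : d ≠ 0 := by
    rintro rfl
    simp at hd
  have hpi : (Real.pi : ℂ) ≠ 0 := Complex.ofReal_ne_zero.mpr Real.pi_ne_zero
  have hterm : ∀ k : ℕ,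
      (([3, 1, d + 1].map (poch · k)).prod / ([7/2, d].map (poch · k)).prod) * (1/2) ^ k /
          (k ! : ℂ) =
        15 / 2 * ((1 - 2 / d) * (eulerTerm (k + 2) : ℂ) +
          1 / d * ((((k + 2 : ℕ) : ℝ) * eulerTerm (k + 2) : ℝ) : ℂ)) := by
    intro k
    have hk : (k ! : ℂ) ≠ 0 := Nat.cast_ne_zero.mpr k.factorial_ne_zero
    have hp : poch d k ≠ 0 := poch_ne_zero hd k
    have hshift : poch (d + 1) k = poch d k * (d + k) / d := by
      rw [eq_div_iff hd0, mul_comm, mul_poch_add_one]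
    calc _ = poch 3 k / poch (7 / 2) k * (1 / 2) ^ k * ((d + k) / d) := by
          simp only [List.map_cons, List.map_nil, List.prod_cons, List.prod_nil, poch_one, hshift]
          field_simp
      _ = _ := by
          rw [poch_three_div_poch]
          push_cast
          field_simp
          ring
  have h1 := Complex.hasSum_ofReal.mpr ((hasSum_nat_add_iff' 2).mpr hasSum_eulerTerm)
  have h2 := Complex.hasSum_ofReal.mpr ((hasSum_nat_add_iff' 2).mpr hasSum_mul_eulerTerm)
  have hsum := ((h1.mul_left (1 - 2 / d)).add (h2.mul_left (1 / d))).mul_left (15 / 2)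
  rw [hyp, tsum_congr hterm, hsum.tsum_eq]
  norm_num [eulerTerm, Finset.sum_range_succ]
  field_simp
  ring
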